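/- Every cyclic group is absolutely closed in N₂. -/

import Mathlib

universe u

/-- A group is nilpotent of class at most 2 (lies in `N₂`) if its commutator
subgroup is contained in its center. -/
def IsNil2 (G : Type*) [Group G] : Prop :=
  commutator G ≤ Subgroup.center G

/-- The dominion of a subgroup `B` of `A` in the variety `N₂`: the set of `a ∈ A`
such that any two homomorphisms from `A` to a nil-2 group agreeing on `B` agree at `a`. -/
def Dominion {A : Type u} [Group A] (B : Subgroup A) : Set A :=
  {a | ∀ (C : Type u) [Group C], IsNil2 C →
    ∀ f g : A →* C, (∀ b ∈ B, f b = g b) → f a = g a}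

/-- A group `B` is absolutely closed in `N₂` if for every nil-2 group `A`
containing (a copy of) `B` as a subgroup, the dominion of `B` in `A` is `B`. -/
def IsAbsolutelyClosed (B : Type u) [Group B] : Prop :=
  ∀ (A : Type u) [Group A], IsNil2 A →
    ∀ ι : B →* A, Function.Injective ι →
      Dominion ι.range = (ι.range : Set A)

open TensorProduct
open scoped commutatorElement

theorem int_aux (g p q xi xj yi yj : ℤ) (h1 : g ∣ yi*q + p*xj) (h2 : g ∣ yj*p+q*xi)
  (h3 : g ∣ yi*p+p*xi) (h4 : g ∣ yj*q+q*xj) : g ∣ p*xj - q*xi := by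
  obtain ⟨h, p', q', u, v, rfl, rfl, huv⟩ : ∃ h p' q' u v : ℤ, p = h*p' ∧ q = h*q' ∧ u*p'+v*q' = 1 := by
    by_cases h0 : Int.gcd p q = 0
    · rw [Int.gcd_eq_zero_iff] at h0
      exact ⟨0, 1, 0, 1, 0, by simp [h0]⟩
    · obtain ⟨p', hp⟩ := Int.gcd_dvd_left p q
      obtain ⟨q', hq⟩ := Int.gcd_dvd_right p q
      have := Int.gcd_eq_gcd_ab p q
      refine ⟨Int.gcd p q, p', q', Int.gcdA p q, Int.gcdB p q, hp, hq, ?_⟩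
      have h0' : (Int.gcd p q : ℤ) ≠ 0 := by exact_mod_cast h0
      apply mul_left_cancel₀ h0'
      linear_combination -this - Int.gcdA p q * hp - Int.gcdB p q * hq
  obtain ⟨k1, h1⟩ := h1
  obtain ⟨k2, h2⟩ := h2
  obtain ⟨k3, h3⟩ := h3
  obtain ⟨k4, h4⟩ := h4
  refine ⟨-k2 + (v*p'*k4 + u*p'*(k1+k2) - u*q'*k3), ?_⟩
  linear_combination (-1 + u*p') * h2 + v*p'*h4 + u*p'*h1 - u*q'*h3 - (h*p'*(xj+yj))*huv

theorem coords (P : Type*) [AddCommGroup P] [Module.Finite ℤ P] :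
  ∃ (κ : Type) (_ : Fintype κ) (_ : DecidableEq κ) (N : κ → ℕ) (e : κ → P) (c : ∀ k, P →ₗ[ℤ] ZMod (N k)),
    (∀ k, N k • e k = 0) ∧ ∀ (p : P) (z : κ → ℤ), (∀ k, (z k : ZMod (N k)) = c k p) → p = ∑ k, z k • e k := by
  classical
  have : AddGroup.FG P := Module.Finite.iff_addGroup_fg.mp inferInstance
  obtain ⟨n, ι, _, p, hp, m, ⟨E⟩⟩ := AddCommGroup.equiv_free_prod_directSum_zmod P
  let N : Fin n ⊕ ι → ℕ := Sum.elim (fun _ => 0) (fun i => p i ^ m i)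
  let κ := Fin n ⊕ ι
  have F : P ≃+ (∀ k : Fin n ⊕ ι, ZMod (N k)) := E.trans
    ((AddEquiv.prodCongr (Finsupp.linearEquivFunOnFinite ℤ ℤ (Fin n)).toAddEquiv
      (DirectSum.addEquivProd _)).trans
      (LinearEquiv.sumPiEquivProdPi ℤ (Fin n) ι (fun k => ZMod (N k))).symm.toAddEquiv)
  refine ⟨Fin n ⊕ ι, inferInstance, inferInstance, N, fun k => F.symm (Pi.single k 1),
    fun k => ((Pi.evalAddMonoidHom (fun k => ZMod (N k)) k).comp F.toAddMonoidHom).toIntLinearMap, ?_, ?_⟩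
  · intro k
    rw [← map_nsmul, ← Pi.single_smul]
    simp
  · intro p z h
    apply F.injective
    simp only [map_sum, map_zsmul, AddEquiv.apply_symm_apply]
    funext k
    have := h k
    simp at this
    rw [← this, Finset.sum_apply, Finset.sum_eq_single k]
    · simp
    · intro l _ hl
      simp [Pi.single_eq_of_ne hl.symm]
    · simp

theorem fg_claim {P T : Type*} [AddCommGroup P] [Module.Finite ℤ P] [AddCommGroup T]
    (w : P →ₗ[ℤ] P →ₗ[ℤ] T) (hw : ∀ x, w x x = 0) (b x y : P)
    (h : y ⊗ₜ[ℤ] b + b ⊗ₜ[ℤ] x = 0) : w b x = 0 := by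
  obtain ⟨κ, _, _, N, e, c, he, hc⟩ := coords P
  have hl : ∀ p : P, ∃ z : κ → ℤ, ∀ k, (z k : ZMod (N k)) = c k p := fun p =>
    ⟨fun k => (ZMod.intCast_surjective (c k p)).choose,
     fun k => (ZMod.intCast_surjective (c k p)).choose_spec⟩
  obtain ⟨zb, hzb⟩ := hl b
  obtain ⟨zx, hzx⟩ := hl x
  obtain ⟨zy, hzy⟩ := hl y
  have key : ∀ (i j : κ) (g : ℕ), g ∣ N i → g ∣ N j → (g : ℤ) ∣ zy i * zb j + zb i * zx j := by
    intro i j g hi hj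
    let Ci : P →ₗ[ℤ] ZMod g := (ZMod.castHom hi (ZMod g)).toAddMonoidHom.toIntLinearMap ∘ₗ c i
    let Cj : P →ₗ[ℤ] ZMod g := (ZMod.castHom hj (ZMod g)).toAddMonoidHom.toIntLinearMap ∘ₗ c j
    have hCi : ∀ (p : P) (z : κ → ℤ), (∀ k, (z k : ZMod (N k)) = c k p) → Ci p = z i := by
      intro p z hz
      change ZMod.castHom hi (ZMod g) (c i p) = _
      rw [← hz, map_intCast]
    have hCj : ∀ (p : P) (z : κ → ℤ), (∀ k, (z k : ZMod (N k)) = c k p) → Cj p = z j := by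
      intro p z hz
      change ZMod.castHom hj (ZMod g) (c j p) = _
      rw [← hz, map_intCast]
    have := congrArg (LinearMap.mul' ℤ (ZMod g) ∘ₗ TensorProduct.map Ci Cj) h
    simp only [map_add, LinearMap.comp_apply, TensorProduct.map_tmul, LinearMap.mul'_apply,
      map_zero, hCi _ _ hzb, hCj _ _ hzb, hCj _ _ hzx, hCi _ _ hzy] at this
    rw [← ZMod.intCast_zmod_eq_zero_iff_dvd] 
    push_cast
    exact this
  have hanti : ∀ u v, w v u = - w u v := by
    intro u v
    have := hw (u + v)
    simp only [map_add, LinearMap.add_apply, hw, zero_add, add_zero] at this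
    exact eq_neg_of_add_eq_zero_left this
  have expand : w b x = ∑ p : κ × κ, (zb p.1 * zx p.2) • w (e p.1) (e p.2) := by
    conv_lhs => rw [hc b zb hzb, hc x zx hzx]
    rw [Fintype.sum_prod_type]
    simp only [map_sum, LinearMap.sum_apply, map_zsmul, LinearMap.smul_apply, mul_smul,
      Finset.smul_sum]
    rw [Finset.sum_comm]
    refine Finset.sum_congr rfl fun i _ => Finset.sum_congr rfl fun j _ => ?_
    rw [smul_comm]
  rw [expand]
  refine Finset.sum_involution (fun p _ => p.swap) ?_ ?_ (by simp) (by simp)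
  · rintro ⟨i, j⟩ -
    simp only [Prod.fst_swap, Prod.snd_swap]
    rw [hanti (e i) (e j), smul_neg, ← sub_eq_add_neg, ← sub_smul]
    let g := Nat.gcd (N i) (N j)
    have hgi : g ∣ N i := Nat.gcd_dvd_left _ _
    have hgj : g ∣ N j := Nat.gcd_dvd_right _ _
    obtain ⟨k, hk⟩ := int_aux g (zb i) (zb j) (zx i) (zx j) (zy i) (zy j) (key i j g hgi hgj)
      (key j i g hgj hgi) (key i i g hgi hgi) (key j j g hgj hgj)
    rw [hk]
    have h1 : (N i : ℤ) • w (e i) (e j) = 0 := by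
      rw [← LinearMap.smul_apply, ← map_zsmul, natCast_zsmul, he]; simp
    have h2 : (N j : ℤ) • w (e i) (e j) = 0 := by
      rw [← map_zsmul, natCast_zsmul, he]; simp
    have : (g : ℤ) • w (e i) (e j) = 0 := by
      change ((Nat.gcd (N i) (N j) : ℕ) : ℤ) • _ = _
      rw [Nat.gcd_eq_gcd_ab, add_smul, mul_comm, mul_smul, h1, mul_comm, mul_smul, h2]; simp
    rw [mul_comm, mul_smul, this, smul_zero]
  · rintro ⟨i, j⟩ - hne heq
    simp only [Prod.swap_prod_mk, Prod.mk.injEq] at heq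
    obtain ⟨rfl, -⟩ := heq
    exact hne (by simp [hw])

theorem gen_claim {M T : Type*} [AddCommGroup M] [AddCommGroup T]
    (w : M →ₗ[ℤ] M →ₗ[ℤ] T) (hw : ∀ x, w x x = 0) (b x y : M)
    (h : y ⊗ₜ[ℤ] b + b ⊗ₜ[ℤ] x = 0) : w b x = 0 := by
  let P : Submodule ℤ M := Submodule.span ℤ {b, x, y}
  have hP : P.FG := Submodule.fg_span (by simp)
  have hb : b ∈ P := Submodule.subset_span (by simp)
  have hx : x ∈ P := Submodule.subset_span (by simp)
  have hy : y ∈ P := Submodule.subset_span (by simp)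
  obtain ⟨Q, hPQ, hQ, hQ0⟩ := TensorProduct.eq_zero_of_fg_of_subtype_eq_zero (N := M) hP
    (t := (⟨y, hy⟩ : P) ⊗ₜ[ℤ] b + (⟨b, hb⟩ : P) ⊗ₜ[ℤ] x) (by simpa using h)
  replace hQ0 := congrArg (TensorProduct.comm ℤ Q M) hQ0
  simp only [map_add, LinearMap.rTensor_tmul, TensorProduct.comm_tmul, map_zero] at hQ0
  obtain ⟨R, hQR, hR, hR0⟩ := TensorProduct.eq_zero_of_fg_of_subtype_eq_zero (N := Q) hQ
    (t := (⟨b, hPQ hb⟩ : Q) ⊗ₜ[ℤ] (⟨y, hPQ hy⟩ : Q) + (⟨x, hPQ hx⟩ : Q) ⊗ₜ[ℤ] (⟨b, hPQ hb⟩ : Q))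
    (by
      simp only [map_add, LinearMap.rTensor_tmul]; exact hQ0)
  replace hR0 := congrArg (TensorProduct.map (Submodule.inclusion hQR) LinearMap.id) (congrArg (TensorProduct.comm ℤ R Q) hR0)
  simp only [map_add, LinearMap.rTensor_tmul, TensorProduct.comm_tmul, TensorProduct.map_tmul, map_zero] at hR0
  have : Module.Finite ℤ R := Module.Finite.iff_fg.mpr hR
  exact fg_claim (w.compl₁₂ R.subtype R.subtype) (fun x => hw x)
    ⟨b, hQR (hPQ hb)⟩ ⟨x, hQR (hPQ hx)⟩ ⟨y, hQR (hPQ hy)⟩ hR0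

theorem exists_tau {M : Type*} [AddCommGroup M]
    (w : M →ₗ[ℤ] M →ₗ[ℤ] AddCircle (1 : ℚ)) (hw : ∀ x, w x x = 0) (b : M) :
    ∃ τ : M →ₗ[ℤ] M →ₗ[ℤ] AddCircle (1 : ℚ), (∀ x, τ b x = w b x) ∧ ∀ y, τ y b = 0 := by
  let F : M × M →ₗ[ℤ] M ⊗[ℤ] M :=
    ((TensorProduct.mk ℤ M M).flip b).coprod (TensorProduct.mk ℤ M M b)
  have hF : ∀ y x, F (y, x) = y ⊗ₜ[ℤ] b + b ⊗ₜ[ℤ] x := fun y x => LinearMap.coprod_apply _ _ _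
  let L : M × M →ₗ[ℤ] AddCircle (1 : ℚ) := w b ∘ₗ LinearMap.snd ℤ M M
  have hL : LinearMap.ker F ≤ LinearMap.ker L := by
    rintro ⟨y, x⟩ hyx
    rw [LinearMap.mem_ker, hF] at hyx
    exact gen_claim w hw b x y hyx
  obtain ⟨c, hc⟩ := CharacterModule.dual_surjective_of_injective
    ((LinearMap.ker F).liftQ F le_rfl) (by
      rw [← LinearMap.ker_eq_bot]; exact Submodule.ker_liftQ_eq_bot _ _ _ le_rfl)
    (((LinearMap.ker F).liftQ L hL).toAddMonoidHom)
  have hcF : ∀ y x, c (y ⊗ₜ[ℤ] b + b ⊗ₜ[ℤ] x) = w b x := by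
    intro y x
    have := DFunLike.congr_fun hc (Submodule.Quotient.mk (y, x))
    rw [← hF]
    exact this
  refine ⟨(TensorProduct.mk ℤ M M).compr₂ (AddMonoidHom.toIntLinearMap c), fun x => ?_, fun y => ?_⟩
  · have := hcF 0 x
    rw [TensorProduct.zero_tmul, zero_add] at this
    exact this
  · have := hcF y 0
    rw [TensorProduct.tmul_zero, add_zero, map_zero] at this
    exact this

/-- The class of an element in the additive abelianization. -/
def abm {A : Type*} [Group A] (x : A) : Additive (Abelianization A) :=
  Additive.ofMul (Abelianization.of x)

section abm
variable {A : Type*} [Group A]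

theorem abm_mul (x y : A) : abm (x * y) = abm x + abm y := by simp [abm]
theorem abm_one : abm (1 : A) = 0 := by simp [abm]
theorem abm_inv (x : A) : abm (x⁻¹) = - abm x := by simp [abm]
theorem abm_zpow (x : A) (n : ℤ) : abm (x ^ n) = n • abm x := by simp [abm]
theorem abm_eq_zero {x : A} : abm x = 0 ↔ x ∈ commutator A := by
  rw [← Abelianization.ker_of]; rfl
end abm

theorem IsNil2.comm_mem {A : Type*} [Group A] (hA : IsNil2 A) (x y : A) :
    ⁅x, y⁆ ∈ Subgroup.center A :=
  hA (Subgroup.commutator_mem_commutator (Subgroup.mem_top _) (Subgroup.mem_top _))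

theorem isNil2_of_comm {A : Type*} [Group A] (h : ∀ x y z : A, z * ⁅x, y⁆ = ⁅x, y⁆ * z) :
    IsNil2 A := by
  unfold IsNil2
  rw [commutator_def, Subgroup.commutator_le]
  intro x _ y _
  rw [Subgroup.mem_center_iff]
  exact h x y

theorem IsNil2.comm_mul_right {A : Type*} [Group A] (hA : IsNil2 A) (x y z : A) :
    ⁅x, y * z⁆ = ⁅x, y⁆ * ⁅x, z⁆ := by
  have h := Subgroup.mem_center_iff.1 (hA.comm_mem x z) y
  have : ⁅x, y * z⁆ = ⁅x, y⁆ * (y * ⁅x, z⁆) * y⁻¹ := by simp only [commutatorElement_def]; group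
  rw [this, h]; group

theorem IsNil2.comm_mul_left {A : Type*} [Group A] (hA : IsNil2 A) (x y z : A) :
    ⁅x * y, z⁆ = ⁅x, z⁆ * ⁅y, z⁆ := by
  rw [← commutatorElement_inv, hA.comm_mul_right, mul_inv_rev, commutatorElement_inv,
    commutatorElement_inv, Subgroup.mem_center_iff.1 (hA.comm_mem x z)]

theorem exists_w {A : Type*} [Group A] (hA : IsNil2 A)
    (χ : Additive (Subgroup.center A) →+ AddCircle (1 : ℚ)) :
    ∃ w : Additive (Abelianization A) →ₗ[ℤ] Additive (Abelianization A) →ₗ[ℤ] AddCircle (1 : ℚ),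
      ∀ x y, w (abm x) (abm y) = χ (Additive.ofMul ⟨⁅x, y⁆, hA.comm_mem x y⟩) := by
  let h : A → (A →* Multiplicative (AddCircle (1 : ℚ))) := fun x => MonoidHom.mk'
    (fun y => Multiplicative.ofAdd (χ (Additive.ofMul ⟨⁅x, y⁆, hA.comm_mem x y⟩))) (by
      intro y z
      rw [← ofAdd_add, ← map_add, ← ofMul_mul]
      congr 4
      exact hA.comm_mul_right x y z)
  let w1 : A →* (Abelianization A →* Multiplicative (AddCircle (1 : ℚ))) :=
    MonoidHom.mk' (fun x => Abelianization.lift (h x)) (by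
      intro x y
      apply Abelianization.hom_ext
      ext z
      change Multiplicative.ofAdd (χ (Additive.ofMul ⟨⁅x * y, z⁆, _⟩)) =
        Multiplicative.ofAdd (χ (Additive.ofMul ⟨⁅x, z⁆, _⟩)) *
        Multiplicative.ofAdd (χ (Additive.ofMul ⟨⁅y, z⁆, _⟩))
      rw [← ofAdd_add, ← map_add, ← ofMul_mul]
      congr 4
      exact hA.comm_mul_left x y z)
  let w2 := Abelianization.lift w1
  refine ⟨AddMonoidHom.toIntLinearMap (AddMonoidHom.mk'
    (fun u => (MonoidHom.toAdditiveLeft (w2 u.toMul)).toIntLinearMap) ?_), ?_⟩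
  · intro u v
    ext z
    change (w2 (u.toMul * v.toMul) z.toMul).toAdd = _
    rw [map_mul]
    rfl
  · intro x y
    rfl

/-- Underlying set of the twisted product. -/
@[ext] structure TwExt (A : Type u) [Group A]
    (τ : Additive (Abelianization A) →ₗ[ℤ] Additive (Abelianization A) →ₗ[ℤ] AddCircle (1 : ℚ)) :
    Type u where
  x : A
  u : Additive (Abelianization A)
  t : AddCircle (1 : ℚ)

namespace TwExt
variable {A : Type u} [Group A]
  {τ : Additive (Abelianization A) →ₗ[ℤ] Additive (Abelianization A) →ₗ[ℤ] AddCircle (1 : ℚ)}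

instance : Mul (TwExt A τ) := ⟨fun p q => ⟨p.x * q.x, p.u + q.u, p.t + q.t + τ p.u (abm q.x)⟩⟩
instance : One (TwExt A τ) := ⟨⟨1, 0, 0⟩⟩
instance : Inv (TwExt A τ) := ⟨fun p => ⟨p.x⁻¹, -p.u, -p.t + τ p.u (abm p.x)⟩⟩

@[simp] theorem mul_x (p q : TwExt A τ) : (p * q).x = p.x * q.x := rfl
@[simp] theorem mul_u (p q : TwExt A τ) : (p * q).u = p.u + q.u := rfl
@[simp] theorem mul_t (p q : TwExt A τ) : (p * q).t = p.t + q.t + τ p.u (abm q.x) := rfl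
@[simp] theorem one_x : (1 : TwExt A τ).x = 1 := rfl
@[simp] theorem one_u : (1 : TwExt A τ).u = 0 := rfl
@[simp] theorem one_t : (1 : TwExt A τ).t = 0 := rfl
@[simp] theorem inv_x (p : TwExt A τ) : (p⁻¹).x = p.x⁻¹ := rfl
@[simp] theorem inv_u (p : TwExt A τ) : (p⁻¹).u = -p.u := rfl
@[simp] theorem inv_t (p : TwExt A τ) : (p⁻¹).t = -p.t + τ p.u (abm p.x) := rfl

instance : Group (TwExt A τ) := Group.ofLeftAxioms
  (by
    intro p q r
    ext
    · simp [mul_assoc]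
    · simp [add_assoc]
    · simp only [mul_t, mul_u, mul_x, abm_mul, map_add, LinearMap.add_apply]; abel)
  (by
    intro p
    ext <;> simp)
  (by
    intro p
    ext <;> simp)

theorem isNil2 (hA : IsNil2 A) : IsNil2 (TwExt A τ) := by
  apply isNil2_of_comm
  intro p q r
  have hx : ⁅p, q⁆.x = ⁅p.x, q.x⁆ := by simp [commutatorElement_def]
  have hu : ⁅p, q⁆.u = 0 := by simp [commutatorElement_def]
  have h0 : abm ⁅p.x, q.x⁆ = 0 := abm_eq_zero.2
    (Subgroup.commutator_mem_commutator (Subgroup.mem_top _) (Subgroup.mem_top _))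
  ext
  · rw [mul_x, mul_x, hx]; exact Subgroup.mem_center_iff.1 (hA.comm_mem _ _) _
  · simp [hu]
  · rw [mul_t, mul_t, hu, hx, h0]; simp [add_comm]

end TwExt

theorem IsNil2.quotient {E : Type*} [Group E] (hE : IsNil2 E) (N : Subgroup E) [N.Normal] :
    IsNil2 (E ⧸ N) := by
  apply isNil2_of_comm
  intro x y z
  obtain ⟨x, rfl⟩ := QuotientGroup.mk'_surjective N x
  obtain ⟨y, rfl⟩ := QuotientGroup.mk'_surjective N y
  obtain ⟨z, rfl⟩ := QuotientGroup.mk'_surjective N z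
  rw [← map_commutatorElement, ← map_mul, ← map_mul,
    Subgroup.mem_center_iff.1 (hE.comm_mem x y) z]

theorem exists_chi_add {X : Type*} [AddCommGroup X] (S : AddSubgroup X) (c : X) (hc : c ∉ S) :
    ∃ χ : X →+ AddCircle (1 : ℚ), χ c ≠ 0 ∧ ∀ z ∈ S, χ z = 0 := by
  have hne : QuotientAddGroup.mk' S c ≠ 0 := fun h => hc ((QuotientAddGroup.eq_zero_iff _).1 h)
  obtain ⟨φ, hφ⟩ := CharacterModule.exists_character_apply_ne_zero_of_ne_zero hne
  refine ⟨AddMonoidHom.comp φ (QuotientAddGroup.mk' S), hφ, fun z hz => ?_⟩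
  have : QuotientAddGroup.mk' S z = 0 := (QuotientAddGroup.eq_zero_iff _).2 hz
  exact (congrArg φ this).trans (map_zero φ)

theorem exists_chi {A : Type*} [Group A] (b : A) (c : Subgroup.center A)
    (hc : (c : A) ∉ Subgroup.zpowers b) :
    ∃ χ : Additive (Subgroup.center A) →+ AddCircle (1 : ℚ), χ (Additive.ofMul c) ≠ 0 ∧
      ∀ z : Subgroup.center A, (z : A) ∈ Subgroup.zpowers b → χ (Additive.ofMul z) = 0 := by
  let _ : AddCommGroup (Additive (Subgroup.center A)) :=
    { (inferInstance : AddGroup (Additive (Subgroup.center A))) with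
      add_comm := fun x y => Subtype.ext (Subgroup.mem_center_iff.1 y.toMul.2 x.toMul) }
  exact exists_chi_add (Subgroup.toAddSubgroup
    ((Subgroup.zpowers b).subgroupOf (Subgroup.center A))) (Additive.ofMul c) hc

theorem exists_separating {A : Type u} [Group A] (hA : IsNil2 A) (b c : A)
    (hc : c ∈ commutator A) (hcb : c ∉ Subgroup.zpowers b) :
    ∃ (C : Type u) (_ : Group C), IsNil2 C ∧ ∃ f g : A →* C, f b = g b ∧ f c ≠ g c := by
  obtain ⟨χ, hχc, hχb⟩ := exists_chi b ⟨c, hA hc⟩ hcb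
  obtain ⟨w, hw⟩ := exists_w hA χ
  have hw0 : ∀ x, w x x = 0 := by
    intro x
    obtain ⟨y, rfl⟩ : ∃ y, abm y = x := QuotientGroup.mk_surjective x.toMul
    rw [hw]
    have : (⟨⁅y, y⁆, hA.comm_mem y y⟩ : Subgroup.center A) = 1 := Subtype.ext (commutatorElement_self y)
    rw [this]; simp
  obtain ⟨τ, hτ1, hτ2⟩ := exists_tau w hw0 (abm b)
  have hτz : ∀ (n : ℤ) (y : A), τ (n • abm b) (abm y)
      = χ (Additive.ofMul ⟨⁅b ^ n, y⁆, hA.comm_mem _ _⟩) := by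
    intro n y
    rw [map_smul, LinearMap.smul_apply, hτ1, ← LinearMap.smul_apply, ← map_smul, ← abm_zpow, hw]
  have hτx : ∀ (n m : ℤ) (z : A), z ∈ commutator A → τ (n • abm b) (abm (b ^ m * z)) = 0 := by
    intro n m z hz
    rw [abm_mul, abm_eq_zero.2 hz, abm_zpow, add_zero, map_smul, hτ2, smul_zero]
  let N : Subgroup (TwExt A τ) :=
    { carrier := {e | ∃ (n : ℤ) (z : Subgroup.center A), (z : A) ∈ commutator A ∧
        e.x = b ^ n * z ∧ e.u = (-n) • abm b ∧ e.t = - χ (Additive.ofMul z)}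
      one_mem' := ⟨0, 1, one_mem _, by simp, by simp, by simp⟩
      mul_mem' := by
        rintro p q ⟨n, z, hz, hx, hu, ht⟩ ⟨n', z', hz', hx', hu', ht'⟩
        refine ⟨n + n', z * z', mul_mem hz hz', ?_, ?_, ?_⟩
        · have := Subgroup.mem_center_iff.1 z.2 (b ^ n')
          rw [TwExt.mul_x, hx, hx', zpow_add, Subgroup.coe_mul, mul_assoc, ← mul_assoc (z : A),
            ← this]
          simp only [mul_assoc]
        · rw [TwExt.mul_u, hu, hu', ← add_smul, neg_add]
        · rw [TwExt.mul_t, hu, hx', hτx _ _ _ hz', ht, ht', ofMul_mul, map_add, neg_add, add_zero]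
      inv_mem' := by
        rintro p ⟨n, z, hz, hx, hu, ht⟩
        refine ⟨-n, z⁻¹, inv_mem hz, ?_, ?_, ?_⟩
        · have := Subgroup.mem_center_iff.1 (inv_mem z.2) (b ^ (-n))
          rw [TwExt.inv_x, hx, mul_inv_rev, Subgroup.coe_inv, this, zpow_neg]
        · rw [TwExt.inv_u, hu, ← neg_smul]
        · rw [TwExt.inv_t, hu, hx, hτx _ _ _ hz, ht, ofMul_inv, map_neg, add_zero] }
  have hN : N.Normal := by
    constructor
    rintro e ⟨n, z, hz, hx, hu, ht⟩ p
    refine ⟨n, ⟨⁅p.x, b ^ n⁆, hA.comm_mem _ _⟩ * z, mul_mem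
      (Subgroup.commutator_mem_commutator (Subgroup.mem_top _) (Subgroup.mem_top _)) hz, ?_, ?_, ?_⟩
    · have h1 := Subgroup.mem_center_iff.1 z.2 (p.x)⁻¹
      have h2 := Subgroup.mem_center_iff.1 (hA.comm_mem p.x (b ^ n)) (b ^ n)
      rw [TwExt.mul_x, TwExt.mul_x, TwExt.inv_x, hx, Subgroup.coe_mul, ← mul_assoc (b ^ n) _ (z : A), h2,
        mul_assoc, mul_assoc, ← h1, commutatorElement_def]
      group
    · simp [hu]
    · have h3 : τ p.u (abm e.x) = 0 := by
        rw [hx, abm_mul, abm_eq_zero.2 hz, abm_zpow, add_zero, map_smul, hτ2, smul_zero]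
      have h4 : (⟨⁅b ^ n, p.x⁆, hA.comm_mem _ _⟩ : Subgroup.center A) =
          (⟨⁅p.x, b ^ n⁆, hA.comm_mem _ _⟩)⁻¹ := Subtype.ext (commutatorElement_inv _ _).symm
      have h5 := hτz n p.x
      rw [h4, ofMul_inv, map_neg] at h5
      rw [ofMul_mul, map_add, neg_add, ← h5, ← ht]
      simp only [TwExt.mul_t, TwExt.mul_u, TwExt.inv_t, TwExt.inv_x, h3, hu, abm_inv, map_neg,
        map_add, LinearMap.add_apply, neg_smul, LinearMap.neg_apply]
      abel
  let f0 : A →* TwExt A τ := MonoidHom.mk' (fun x => ⟨x, 0, 0⟩) (by intro x y; ext <;> simp)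
  let g0 : A →* TwExt A τ := MonoidHom.mk' (fun x => ⟨1, abm x, 0⟩)
    (by intro x y; ext <;> simp [abm_mul, abm_one])
  refine ⟨TwExt A τ ⧸ N, inferInstance, (TwExt.isNil2 hA).quotient N,
    (QuotientGroup.mk' N).comp f0, (QuotientGroup.mk' N).comp g0, ?_, ?_⟩
  · symm
    refine QuotientGroup.eq.2 ?_
    refine ⟨1, 1, one_mem _, ?_, ?_, ?_⟩ <;> simp [f0, g0, hτ2, abm_one]
  · intro h
    have hg : g0 c = 1 := by
      ext <;> simp [g0, abm_eq_zero.2 hc]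
    rw [MonoidHom.comp_apply, MonoidHom.comp_apply, hg, map_one] at h
    obtain ⟨n, z, hz, hx, hu, ht⟩ := (QuotientGroup.eq_one_iff _).1 h
    replace hx : c = b ^ n * z := hx
    replace hu : 0 = (-n) • abm b := hu
    replace ht : 0 = - χ (Additive.ofMul z) := ht
    have hbn : b ^ n ∈ commutator A := by
      rw [← abm_eq_zero, abm_zpow]
      simpa using hu.symm
    apply hχc
    have : (⟨c, hA hc⟩ : Subgroup.center A) = ⟨b ^ n, hA hbn⟩ * z := Subtype.ext hx
    rw [this, ofMul_mul, map_add, hχb ⟨b ^ n, hA hbn⟩ ⟨n, rfl⟩, zero_add]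
    exact neg_eq_zero.1 ht.symm

/-- Every cyclic group is absolutely closed in `N₂`. -/
theorem absolutelyClosed_of_isCyclic {G : Type u} [Group G] (hG : IsCyclic G) :
    IsAbsolutelyClosed G := by
  intro A _ hA ι hι
  obtain ⟨b0, hb0⟩ := hG.exists_generator
  have hr : ι.range = Subgroup.zpowers (ι b0) := by
    rw [← MonoidHom.map_zpowers, MonoidHom.range_eq_map]
    congr 1
    exact ((Subgroup.eq_top_iff' _).2 hb0).symm
  rw [hr]
  generalize ι b0 = b
  apply Set.Subset.antisymm
  swap
  · intro a ha C _ _ f g h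
    exact h a ha
  intro a ha
  have key : ∀ (C : Type u) [Group C], IsNil2 C → ∀ f g : A →* C, f b = g b → f a = g a := by
    intro C _ hC f g h
    apply ha C hC f g
    rintro _ ⟨n, rfl⟩
    simp [h]
  obtain ⟨n, c, hc, rfl⟩ : ∃ (n : ℤ) (c : A), c ∈ commutator A ∧ a = b ^ n * c := by
    have h := key (Abelianization A ⧸ Subgroup.zpowers (Abelianization.of b))
      (isNil2_of_comm fun x y z => mul_comm _ _)
      ((QuotientGroup.mk' _).comp Abelianization.of) 1 (by
        exact (QuotientGroup.eq_one_iff _).2 (Subgroup.mem_zpowers _))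
    obtain ⟨n, hn⟩ := (QuotientGroup.eq_one_iff _).1 h
    refine ⟨n, (b ^ n)⁻¹ * a, ?_, by group⟩
    rw [← Abelianization.ker_of, MonoidHom.mem_ker, map_mul, map_inv, map_zpow]
    simp only at hn
    rw [hn, inv_mul_cancel]
  by_contra hcon
  have hcb : c ∉ Subgroup.zpowers b := fun h =>
    hcon (mul_mem (Subgroup.zpow_mem_zpowers b n) h)
  obtain ⟨C, _, hC, f, g, hb, hfg⟩ := exists_separating hA b c hc hcb
  apply hfg
  have := key C hC f g hb
  simpa [hb] using this
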